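/- arXiv:2412.20652 — 5 statements merged into one kernel-verified Lean document; each statement's English description precedes it below -/
import Mathlib

section
/- In the polynomial ring ℤ[t], for all integers p ≥ 3 and k ≥ 1 one has the identity (1−t^p)(1−t^{kp+1})(1 + A + B + C) = (1−t)(1 − (1−t)(t^{(p−1)(kp+1)+1} + t^{kp+1}) − t^{p(kp+1)+2}), where A, B, C are the explicit polynomials defined below. (This identity shows that the explicit polynomial 1 + A + B + C equals the Alexander polynomial of the twisted torus knot T(p,kp+1;2,1) as computed from Morton's formula.) -/
open Polynomial Finset

theorem one_sub_mul_sum_Icc_pow_pred_mul {R : Type*} [CommRing R] (x : R) (m n : ℕ) :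
    (1 - x ^ m) * ∑ i ∈ Icc 1 n, x ^ ((i - 1) * m) = 1 - x ^ (n * m) := by
  induction n with
  | zero => simp
  | succ n ih =>
    rw [sum_Icc_succ_top (by lia), mul_add, ih, Nat.add_sub_cancel]
    ring

theorem one_sub_mul_sum_Icc_pow {R : Type*} [CommRing R] (x : R) (n : ℕ) :
    (1 - x) * ∑ i ∈ Icc 1 n, x ^ i = x - x ^ (n + 1) := by
  induction n with
  | zero => simp
  | succ n ih =>
    rw [sum_Icc_succ_top (by lia), mul_add, ih]
    ring

/-- In `ℤ[t]`, for integers `p ≥ 3` and `k ≥ 1`, the identity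
`(1−t^p)(1−t^{kp+1})(1 + A + B + C)
  = (1−t)(1 − (1−t)(t^{(p−1)(kp+1)+1} + t^{kp+1}) − t^{p(kp+1)+2})`,
where `A`, `B`, `C` are the explicit polynomials from the paper. -/
theorem twisted_torus_alexander_identity (p k : ℕ) (hp : 3 ≤ p) (hk : 1 ≤ k) :
    (1 - (X : ℤ[X]) ^ p) * (1 - X ^ (k * p + 1)) *
      (1 + (∑ i ∈ Icc 1 k, (-X + X ^ p) * X ^ ((i - 1) * p))
         + (∑ i ∈ Icc 1 (p - 3), ∑ j ∈ Icc 1 k,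
             (-X ^ (i * k * p + 1) + X ^ (i * k * p + 2)
               - X ^ (i * k * p + 2 + i) + X ^ ((i * k + 1) * p)) * X ^ ((j - 1) * p))
         + (∑ i ∈ Icc 1 (k + 1),
             (-X ^ (k * p * (p - 2) + 1) + X ^ (k * p * (p - 2) + 2)) * X ^ ((i - 1) * p)))
    = (1 - X) *
        (1 - (1 - X) * (X ^ ((p - 1) * (k * p + 1) + 1) + X ^ (k * p + 1))
           - X ^ (p * (k * p + 1) + 2)) := by
  obtain ⟨n, rfl⟩ := Nat.exists_eq_add_of_le' hp
  have hA := one_sub_mul_sum_Icc_pow_pred_mul (X : ℤ[X]) (n + 3) k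
  have hC := one_sub_mul_sum_Icc_pow_pred_mul (X : ℤ[X]) (n + 3) (k + 1)
  have hQ := one_sub_mul_sum_Icc_pow ((X : ℤ[X]) ^ (k * (n + 3))) n
  have hXQ := one_sub_mul_sum_Icc_pow ((X : ℤ[X]) ^ (k * (n + 3) + 1)) n
  have hB : ∀ i : ℕ, -(X : ℤ[X]) ^ (i * k * (n + 3) + 1) + X ^ (i * k * (n + 3) + 2)
      - X ^ (i * k * (n + 3) + 2 + i) + X ^ ((i * k + 1) * (n + 3))
      = (X ^ (n + 3) - X + X ^ 2) * (X ^ (k * (n + 3))) ^ i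
        - X ^ 2 * (X ^ (k * (n + 3) + 1)) ^ i := fun i => by ring
  have h₁ : n + 3 - 1 = n + 2 := by lia
  have h₂ : n + 3 - 2 = n + 1 := by lia
  simp only [Nat.add_sub_cancel, h₁, h₂, hB, ← mul_sum, ← sum_mul, sum_sub_distrib]
  have e₁ : (X : ℤ[X]) ^ (k * (n + 3) + 1) = X ^ (k * (n + 3)) * X := pow_succ _ _
  have e₂ : (X : ℤ[X]) ^ ((k + 1) * (n + 3)) = X ^ (k * (n + 3)) * X ^ (n + 3) := by ring
  have e₃ : (X : ℤ[X]) ^ (k * (n + 3) * (n + 1) + 1) = (X ^ (k * (n + 3))) ^ (n + 1) * X := by ring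
  have e₄ : (X : ℤ[X]) ^ (k * (n + 3) * (n + 1) + 2) = (X ^ (k * (n + 3))) ^ (n + 1) * X ^ 2 := by
    ring
  have e₅ : (X : ℤ[X]) ^ ((n + 2) * (k * (n + 3) + 1) + 1)
      = (X ^ (k * (n + 3))) ^ (n + 2) * X ^ (n + 3) := by ring
  have e₆ : (X : ℤ[X]) ^ ((n + 3) * (k * (n + 3) + 1) + 2)
      = (X ^ (k * (n + 3))) ^ (n + 3) * X ^ (n + 3) * X ^ 2 := by ring
  rw [e₁] at hXQ
  rw [e₂] at hC
  rw [e₁, e₃, e₄, e₅, e₆]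
  generalize (X : ℤ[X]) ^ (k * (n + 3)) = Q at *
  generalize ∑ i ∈ Icc 1 k, (X : ℤ[X]) ^ ((i - 1) * (n + 3)) = S at *
  generalize ∑ i ∈ Icc 1 (k + 1), (X : ℤ[X]) ^ ((i - 1) * (n + 3)) = S' at *
  generalize ∑ i ∈ Icc 1 n, Q ^ i = U at *
  generalize ∑ i ∈ Icc 1 n, (Q * X) ^ i = V at *
  linear_combination
    (1 - Q * X) * ((X ^ (n + 3) - X) + (X ^ (n + 3) - X + X ^ 2) * U - X ^ 2 * V) * hA
      + (1 - Q * X) * (X ^ 2 - X) * Q ^ (n + 1) * hC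
      + (1 - Q * X) * (X ^ (n + 3) - X + X ^ 2) * hQ - (1 - Q) * X ^ 2 * hXQ
end

section
/- In the polynomial ring ℤ[t], for all integers p ≥ 3 and k ≥ 1 one has the identity (1−t^p)(1 + A + B + C) = (1−t)(1 + t^{kp+2}·Σ_{i=0}^{p−3} t^{i(kp+1)} + t^{(p−1)(kp+1)+2}), where A, B, C are the explicit polynomials defined below. -/
open Polynomial Finset

theorem one_sub_mul_sum_Icc_mul_pow {R : Type*} [CommRing R] (a x : R) (p k : ℕ) :
    (1 - x ^ p) * ∑ j ∈ Icc 1 k, a * x ^ ((j - 1) * p) = a * (1 - x ^ (k * p)) := by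
  induction k with
  | zero => simp
  | succ k ih =>
    rw [sum_Icc_succ_top (by omega), mul_add, ih, Nat.add_sub_cancel]
    ring

theorem sum_Icc_mul_one_sub_telescope {R : Type*} [CommRing R] (q x y : R) (n : ℕ) :
    ∑ i ∈ Icc 1 n, q ^ i * (-x + x ^ 2 - x ^ (2 + i) + y) * (1 - q)
      = (x ^ 2 - x + y) * (q - q ^ (n + 1))
        + (1 - x) * x ^ 2 * q * ∑ i ∈ range (n + 1), (q * x) ^ i
        - x ^ 2 * q + x ^ (n + 3) * q ^ (n + 1) := by
  induction n with
  | zero => simp; ring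
  | succ n ih =>
    rw [sum_Icc_succ_top (by omega), ih, sum_range_succ _ (n + 1)]
    ring

/-- In `ℤ[t]`, for integers `p ≥ 3` and `k ≥ 1`, the identity
`(1−t^p)(1 + A + B + C) = (1−t)(1 + t^{kp+2}·Σ_{i=0}^{p−3} t^{i(kp+1)} + t^{(p−1)(kp+1)+2})`. -/
theorem twisted_torus_alexander_identity' (p k : ℕ) (hp : 3 ≤ p) (hk : 1 ≤ k) :
    (1 - (X : ℤ[X]) ^ p) *
      (1 + (∑ i ∈ Icc 1 k, (-X + X ^ p) * X ^ ((i - 1) * p))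
         + (∑ i ∈ Icc 1 (p - 3), ∑ j ∈ Icc 1 k,
             (-X ^ (i * k * p + 1) + X ^ (i * k * p + 2)
               - X ^ (i * k * p + 2 + i) + X ^ ((i * k + 1) * p)) * X ^ ((j - 1) * p))
         + (∑ i ∈ Icc 1 (k + 1),
             (-X ^ (k * p * (p - 2) + 1) + X ^ (k * p * (p - 2) + 2)) * X ^ ((i - 1) * p)))
    = (1 - X) *
        (1 + X ^ (k * p + 2) * (∑ i ∈ range (p - 2), X ^ (i * (k * p + 1)))
           + X ^ ((p - 1) * (k * p + 1) + 2)) := by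
  obtain ⟨n, rfl⟩ := Nat.exists_eq_add_of_le' hp
  simp only [mul_add (1 - (X : ℤ[X]) ^ (n + 3)), mul_sum (Icc 1 (n + 3 - 3)),
    one_sub_mul_sum_Icc_mul_pow]
  have hB := sum_Icc_mul_one_sub_telescope ((X : ℤ[X]) ^ (k * (n + 3))) X (X ^ (n + 3)) n
  have hterm (i : ℕ) : -(X : ℤ[X]) ^ (i * k * (n + 3) + 1) + X ^ (i * k * (n + 3) + 2)
      - X ^ (i * k * (n + 3) + 2 + i) + X ^ ((i * k + 1) * (n + 3))
      = (X ^ (k * (n + 3))) ^ i * (-X + X ^ 2 - X ^ (2 + i) + X ^ (n + 3)) := by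
    ring
  have hpow (i : ℕ) : (X : ℤ[X]) ^ (i * (k * (n + 3) + 1)) = (X ^ (k * (n + 3)) * X) ^ i := by
    ring
  simp only [hterm, hpow, Nat.add_sub_cancel, show n + 3 - 2 = n + 1 by omega, hB]
  generalize ∑ i ∈ range (n + 1), ((X : ℤ[X]) ^ (k * (n + 3)) * X) ^ i = S
  rw [show n + 3 - 1 = n + 2 by omega]
  ring
end

section
/- For all integers p ≥ 3 and k ≥ 1, the polynomial P = 1 + A + B + C ∈ ℤ[t] (with A, B, C as defined below) has degree kp(p−1)+2, leading coefficient 1, constant coefficient 1, and every coefficient of P lies in {−1, 0, 1}. -/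
open Polynomial Finset

theorem Finset.sum_Icc_one_add_sub_one {M : Type*} [AddCommMonoid M] (f : ℕ → M) (a k : ℕ) :
    ∑ j ∈ Icc 1 k, f (a + (j - 1)) = ∑ m ∈ Ico a (a + k), f m := by
  induction k with
  | zero => simp
  | succ k ih =>
    rw [Finset.sum_Icc_succ_top (by omega), ih, ← add_assoc a k 1,
      Finset.sum_Ico_succ_top (by omega), Nat.add_sub_cancel]

theorem Finset.sum_Icc_one_blocks {M : Type*} [AddCommMonoid M] (f : ℕ → M) (k N : ℕ) :
    ∑ i ∈ Icc 1 N, ∑ j ∈ Icc 1 k, f (i * k + (j - 1)) = ∑ m ∈ Ico k (k * (N + 1)), f m := by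
  induction N with
  | zero => simp
  | succ N ih =>
    rw [Finset.sum_Icc_succ_top (by omega), ih, Finset.sum_Icc_one_add_sub_one,
      mul_comm (N + 1) k, Finset.sum_Ico_consecutive _ (by nlinarith) (by omega), mul_add k (N + 1),
      mul_one]

theorem Polynomial.coeff_sum_X_pow_mul_add {R : Type*} [Semiring R] {p r : ℕ} (hr : r < p)
    (S : Finset ℕ) (n : ℕ) :
    (∑ m ∈ S, (X : R[X]) ^ (m * p + r)).coeff n = if n % p = r ∧ n / p ∈ S then 1 else 0 := by
  have h (m : ℕ) : n = m * p + r ↔ n % p = r ∧ n / p = m := by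
    rw [and_comm, Nat.div_mod_unique (by omega), mul_comm p m, add_comm r]
    exact ⟨fun h => ⟨h.symm, hr⟩, fun h => h.1.symm⟩
  simp only [finsetSum_coeff, coeff_X_pow, h]
  by_cases hn : n % p = r <;> simp [hn]

/-- The defining expression of the Alexander polynomial with `p = d + 3`, its terms collected
by the residue of the exponent modulo `p`. -/
theorem twisted_torus_alexander_collect (d k : ℕ) :
    (1 + (∑ i ∈ Icc 1 k, (-X + X ^ (d + 3)) * X ^ ((i - 1) * (d + 3)))
      + (∑ i ∈ Icc 1 d, ∑ j ∈ Icc 1 k,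
          (-X ^ (i * k * (d + 3) + 1) + X ^ (i * k * (d + 3) + 2)
            - X ^ (i * k * (d + 3) + 2 + i) + X ^ ((i * k + 1) * (d + 3)))
          * X ^ ((j - 1) * (d + 3)))
      + (∑ i ∈ Icc 1 (k + 1),
          (-X ^ (k * (d + 3) * (d + 1) + 1) + X ^ (k * (d + 3) * (d + 1) + 2))
          * X ^ ((i - 1) * (d + 3))) : ℤ[X])
    = (∑ m ∈ range (k * (d + 1) + 1), X ^ (m * (d + 3) + 0))
      - (∑ m ∈ range (k * (d + 2) + 1), X ^ (m * (d + 3) + 1))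
      + (∑ m ∈ Ico k (k * (d + 2) + 1), X ^ (m * (d + 3) + 2))
      - ∑ i ∈ Icc 1 d, ∑ m ∈ Ico (i * k) (i * k + k), X ^ (m * (d + 3) + (2 + i)) := by
  have hA : (∑ i ∈ Icc 1 k, (-X + X ^ (d + 3)) * X ^ ((i - 1) * (d + 3)) : ℤ[X])
      = -(∑ m ∈ Ico 0 k, X ^ (m * (d + 3) + 1)) + ∑ m ∈ Ico 0 k, X ^ ((m + 1) * (d + 3)) := by
    rw [← Finset.sum_neg_distrib, ← Finset.sum_add_distrib]
    have := Finset.sum_Icc_one_add_sub_one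
      (fun m => (-X ^ (m * (d + 3) + 1) + X ^ ((m + 1) * (d + 3)) : ℤ[X])) 0 k
    rw [zero_add] at this
    rw [← this]
    refine Finset.sum_congr rfl fun i _ => ?_
    ring
  have hB : (∑ i ∈ Icc 1 d, ∑ j ∈ Icc 1 k,
        (-X ^ (i * k * (d + 3) + 1) + X ^ (i * k * (d + 3) + 2)
          - X ^ (i * k * (d + 3) + 2 + i) + X ^ ((i * k + 1) * (d + 3)))
        * X ^ ((j - 1) * (d + 3)) : ℤ[X])
      = -(∑ m ∈ Ico k (k * (d + 1)), X ^ (m * (d + 3) + 1))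
        + (∑ m ∈ Ico k (k * (d + 1)), X ^ (m * (d + 3) + 2))
        - (∑ i ∈ Icc 1 d, ∑ m ∈ Ico (i * k) (i * k + k), X ^ (m * (d + 3) + (2 + i)))
        + ∑ m ∈ Ico k (k * (d + 1)), X ^ ((m + 1) * (d + 3)) := by
    simp only [← Finset.sum_Icc_one_blocks, ← Finset.sum_Icc_one_add_sub_one,
      ← Finset.sum_neg_distrib, ← Finset.sum_add_distrib, ← Finset.sum_sub_distrib]
    refine Finset.sum_congr rfl fun i _ => Finset.sum_congr rfl fun j _ => ?_
    ring
  have hC : (∑ i ∈ Icc 1 (k + 1),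
        (-X ^ (k * (d + 3) * (d + 1) + 1) + X ^ (k * (d + 3) * (d + 1) + 2))
        * X ^ ((i - 1) * (d + 3)) : ℤ[X])
      = -(∑ m ∈ Ico (k * (d + 1)) (k * (d + 2) + 1), X ^ (m * (d + 3) + 1))
        + ∑ m ∈ Ico (k * (d + 1)) (k * (d + 2) + 1), X ^ (m * (d + 3) + 2) := by
    rw [show k * (d + 2) + 1 = k * (d + 1) + (k + 1) by ring]
    simp only [← Finset.sum_Icc_one_add_sub_one, ← Finset.sum_neg_distrib,
      ← Finset.sum_add_distrib]
    refine Finset.sum_congr rfl fun i _ => ?_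
    ring
  have h₁ : k ≤ k * (d + 1) := by nlinarith
  have h₂ : k * (d + 1) ≤ k * (d + 2) + 1 := by nlinarith
  rw [hA, hB, hC, Finset.sum_range_succ' _ (k * (d + 1)), Finset.range_eq_Ico,
    Finset.range_eq_Ico,
    ← Finset.sum_Ico_consecutive _ (Nat.zero_le k) h₁,
    ← Finset.sum_Ico_consecutive _ h₁ h₂,
    ← Finset.sum_Ico_consecutive _ (Nat.zero_le k) (h₁.trans h₂),
    ← Finset.sum_Ico_consecutive _ h₁ h₂]
  simp only [add_zero, zero_mul, pow_zero]
  ring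

theorem twisted_torus_alexander_coeff (d k n : ℕ) :
    ((∑ m ∈ range (k * (d + 1) + 1), X ^ (m * (d + 3) + 0))
      - (∑ m ∈ range (k * (d + 2) + 1), X ^ (m * (d + 3) + 1))
      + (∑ m ∈ Ico k (k * (d + 2) + 1), X ^ (m * (d + 3) + 2))
      - ∑ i ∈ Icc 1 d, ∑ m ∈ Ico (i * k) (i * k + k), X ^ (m * (d + 3) + (2 + i)) : ℤ[X]).coeff n
    = (if n % (d + 3) = 0 ∧ n / (d + 3) ≤ k * (d + 1) then 1 else 0)
      - (if n % (d + 3) = 1 ∧ n / (d + 3) ≤ k * (d + 2) then 1 else 0)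
      + (if n % (d + 3) = 2 ∧ k ≤ n / (d + 3) ∧ n / (d + 3) ≤ k * (d + 2) then 1 else 0)
      - (if 3 ≤ n % (d + 3) ∧ (n % (d + 3) - 2) * k ≤ n / (d + 3) ∧
          n / (d + 3) < (n % (d + 3) - 2) * k + k then 1 else 0) := by
  have hlt : n % (d + 3) < d + 3 := Nat.mod_lt _ (by omega)
  have hB : (∑ i ∈ Icc 1 d, ∑ m ∈ Ico (i * k) (i * k + k),
      (X : ℤ[X]) ^ (m * (d + 3) + (2 + i))).coeff n
      = if 3 ≤ n % (d + 3) ∧ (n % (d + 3) - 2) * k ≤ n / (d + 3) ∧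
          n / (d + 3) < (n % (d + 3) - 2) * k + k then 1 else 0 := by
    rw [finsetSum_coeff, Finset.sum_congr rfl fun i hi => coeff_sum_X_pow_mul_add
      (by rw [Finset.mem_Icc] at hi; omega) _ n]
    by_cases h : 3 ≤ n % (d + 3)
    · obtain ⟨r, hr⟩ : ∃ r, n % (d + 3) = 2 + r := ⟨n % (d + 3) - 2, by omega⟩
      rw [Finset.sum_eq_single_of_mem r (Finset.mem_Icc.2 (by omega))
        fun i _ hne => if_neg (by omega)]
      simp [hr, show 3 ≤ 2 + r by omega]
    · rw [if_neg (by tauto)]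
      refine Finset.sum_eq_zero fun i hi => if_neg ?_
      rw [Finset.mem_Icc] at hi
      omega
  rw [coeff_sub, coeff_add, coeff_sub, hB, coeff_sum_X_pow_mul_add (by omega),
    coeff_sum_X_pow_mul_add (by omega), coeff_sum_X_pow_mul_add (by omega)]
  simp only [Finset.mem_range, Finset.mem_Ico, Nat.lt_succ_iff]

/-- For integers `p ≥ 3` and `k ≥ 1`, the polynomial `P = 1 + A + B + C ∈ ℤ[t]`
(with `A`, `B`, `C` as in the paper) has degree `kp(p−1)+2`, leading coefficient `1`,
constant coefficient `1`, and every coefficient of `P` lies in `{−1, 0, 1}`. -/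
theorem twisted_torus_alexander_coeffs (p k : ℕ) (hp : 3 ≤ p) (hk : 1 ≤ k)
    (P : ℤ[X])
    (hP : P = 1 + (∑ i ∈ Icc 1 k, (-X + X ^ p) * X ^ ((i - 1) * p))
         + (∑ i ∈ Icc 1 (p - 3), ∑ j ∈ Icc 1 k,
             (-X ^ (i * k * p + 1) + X ^ (i * k * p + 2)
               - X ^ (i * k * p + 2 + i) + X ^ ((i * k + 1) * p)) * X ^ ((j - 1) * p))
         + (∑ i ∈ Icc 1 (k + 1),
             (-X ^ (k * p * (p - 2) + 1) + X ^ (k * p * (p - 2) + 2)) * X ^ ((i - 1) * p))) :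
    P.natDegree = k * p * (p - 1) + 2 ∧ P.leadingCoeff = 1 ∧ P.coeff 0 = 1 ∧
      ∀ n : ℕ, P.coeff n ∈ ({-1, 0, 1} : Set ℤ) := by
  obtain ⟨d, rfl⟩ : ∃ d, p = d + 3 := ⟨p - 3, by omega⟩
  simp only [show d + 3 - 3 = d by omega, show d + 3 - 2 = d + 1 by omega,
    show d + 3 - 1 = d + 2 by omega] at hP ⊢
  rw [twisted_torus_alexander_collect] at hP
  have hcoeff (n : ℕ) := hP ▸ twisted_torus_alexander_coeff d k n
  have htop : P.coeff (k * (d + 3) * (d + 2) + 2) = 1 := by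
    have hdiv : (k * (d + 3) * (d + 2) + 2) / (d + 3) = k * (d + 2) ∧
        (k * (d + 3) * (d + 2) + 2) % (d + 3) = 2 := by
      rw [Nat.div_mod_unique (by omega)]
      exact ⟨by ring, by omega⟩
    rw [hcoeff, hdiv.1, hdiv.2]
    simp [show k ≤ k * (d + 2) by nlinarith]
  have hdeg : P.natDegree = k * (d + 3) * (d + 2) + 2 := by
    refine natDegree_eq_of_le_of_coeff_ne_zero (natDegree_le_iff_coeff_eq_zero.2 fun n hn => ?_)
      (by simp [htop])
    have hn' := Nat.div_add_mod n (d + 3)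
    have hlt : n % (d + 3) < d + 3 := Nat.mod_lt _ (by omega)
    rw [hcoeff]
    generalize n / (d + 3) = q at *
    generalize n % (d + 3) = r at *
    have hq : k * (d + 2) < q ∨ 3 ≤ r ∧ k * (d + 2) ≤ q := by
      by_contra! h
      rcases Nat.lt_or_ge r 3 with h3 | h3
      · nlinarith
      · nlinarith [h.2 h3]
    have hle : k * (d + 1) ≤ k * (d + 2) := by gcongr; omega
    have hr : 3 ≤ r → (r - 2) * k + k ≤ k * (d + 2) := fun h3 => by
      obtain ⟨s, rfl⟩ : ∃ s, r = s + 2 := ⟨r - 2, by omega⟩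
      rw [Nat.add_sub_cancel]
      nlinarith
    rw [if_neg (by omega), if_neg (by omega), if_neg (by omega), if_neg (by omega)]
    rfl
  refine ⟨hdeg, by rw [leadingCoeff, hdeg, htop], by simp [hcoeff], fun n => ?_⟩
  rw [hcoeff]
  simp only [Set.mem_insert_iff, Set.mem_singleton_iff]
  split_ifs <;> omega
end

section
/- For all integers p ≥ 3 and k ≥ 1, the polynomial P = 1 + A + B + C ∈ ℤ[t] (with A, B, C as defined below) is palindromic: for every natural number n, the coefficient of t^n in P equals the coefficient of t^{kp(p−1)+2−n} in P (equivalently, t^{kp(p−1)+2}·P(1/t) = P(t)). -/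
open Polynomial Finset

theorem reflect_finsetSum {R ι : Type*} [Semiring R] (N : ℕ) (s : Finset ι) (f : ι → R[X]) :
    (∑ i ∈ s, f i).reflect N = ∑ i ∈ s, (f i).reflect N := by
  ext n
  simp [coeff_reflect, finsetSum_coeff]

theorem reflect_X_pow_of_add_eq {R : Type*} [Semiring R] {N a b : ℕ} (h : a + b = N) :
    (X ^ a : R[X]).reflect N = X ^ b := by
  rw [← one_mul (X ^ a), ← C_1, reflect_C_mul_X_pow, revAt_le (by omega), C_1, one_mul]
  congr 1
  omega

/-- Reflection sends a sum over an arithmetic progression of exponents to another such sum. -/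
theorem reflect_sum_range_X_pow {R : Type*} [Semiring R] {N a b n p : ℕ}
    (h : a + b + n * p = N + p) :
    (∑ i ∈ range n, (X : R[X]) ^ (a + i * p)).reflect N = ∑ i ∈ range n, X ^ (b + i * p) := by
  rw [reflect_finsetSum, ← sum_range_reflect]
  refine sum_congr rfl fun i hi => reflect_X_pow_of_add_eq ?_
  obtain ⟨d, rfl⟩ := Nat.exists_eq_add_of_lt (mem_range.mp hi)
  rw [show i + d + 1 - 1 - i = d by omega]
  linarith

theorem sum_range_sum_range_add_mul {M : Type*} [AddCommMonoid M] (q k : ℕ) (f : ℕ → M) :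
    ∑ i ∈ range q, ∑ j ∈ range k, f (i * k + j) = ∑ m ∈ range (q * k), f m := by
  induction q with
  | zero => simp
  | succ q ih => rw [sum_range_succ, ih, Nat.succ_mul, sum_range_add]

theorem sum_Icc_one_eq_sum_range {M : Type*} [AddCommMonoid M] (n : ℕ) (f : ℕ → M) :
    ∑ i ∈ Icc 1 n, f i = ∑ i ∈ range n, f (i + 1) := by
  rw [range_eq_Ico, sum_Ico_add' f 0 n 1]
  rfl

theorem reflect_sum_range_sum_range_X_pow {R : Type*} [Semiring R] (q k p : ℕ) (hp : p = q + 3) :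
    (∑ i ∈ range q, ∑ j ∈ range k, (X : R[X]) ^ ((i + 1) * k * p + 3 + i + j * p)).reflect
        (k * p * (q + 2) + 2) =
      ∑ i ∈ range q, ∑ j ∈ range k, X ^ ((i + 1) * k * p + 3 + i + j * p) := by
  rw [reflect_finsetSum, ← sum_range_reflect]
  refine sum_congr rfl fun i hi => reflect_sum_range_X_pow ?_
  obtain ⟨d, rfl⟩ := Nat.exists_eq_add_of_lt (mem_range.mp hi)
  rw [show i + d + 1 - 1 - i = d by omega]
  subst hp
  ring

/-- For integers `p ≥ 3` and `k ≥ 1`, the polynomial `P = 1 + A + B + C ∈ ℤ[t]`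
(with `A`, `B`, `C` as in the paper) is palindromic: for every `n ≤ kp(p−1)+2`, the
coefficient of `t^n` in `P` equals the coefficient of `t^{kp(p−1)+2−n}`; equivalently,
reflecting the coefficients of `P` in degree `kp(p−1)+2` returns `P`
(i.e. `t^{kp(p−1)+2}·P(1/t) = P(t)`). -/
theorem twisted_torus_alexander_palindromic (p k : ℕ) (hp : 3 ≤ p) (hk : 1 ≤ k)
    (P : ℤ[X])
    (hP : P = 1 + (∑ i ∈ Icc 1 k, (-X + X ^ p) * X ^ ((i - 1) * p))
         + (∑ i ∈ Icc 1 (p - 3), ∑ j ∈ Icc 1 k,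
             (-X ^ (i * k * p + 1) + X ^ (i * k * p + 2)
               - X ^ (i * k * p + 2 + i) + X ^ ((i * k + 1) * p)) * X ^ ((j - 1) * p))
         + (∑ i ∈ Icc 1 (k + 1),
             (-X ^ (k * p * (p - 2) + 1) + X ^ (k * p * (p - 2) + 2)) * X ^ ((i - 1) * p))) :
    (∀ n : ℕ, n ≤ k * p * (p - 1) + 2 →
        P.coeff n = P.coeff (k * p * (p - 1) + 2 - n)) ∧
      P.reflect (k * p * (p - 1) + 2) = P := by
  suffices h : P.reflect (k * p * (p - 1) + 2) = P by
    refine ⟨fun n hn => ?_, h⟩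
    conv_lhs => rw [← h, coeff_reflect, revAt_le hn]
  obtain ⟨q, hq⟩ := Nat.exists_eq_add_of_le' hp
  rw [show p - 1 = q + 2 by omega]
  rw [show p - 2 = q + 1 by omega, show p - 3 = q by omega] at hP
  have hA : 1 + ∑ i ∈ Icc 1 k, (-X + X ^ p) * X ^ ((i - 1) * p) =
      ∑ i ∈ range (k + 1), (X : ℤ[X]) ^ (0 + i * p) - ∑ i ∈ range k, X ^ (1 + i * p) := by
    rw [sum_Icc_one_eq_sum_range, sum_range_succ', add_sub_right_comm, ← sum_sub_distrib]
    simp only [zero_mul, add_zero, pow_zero, add_comm (1 : ℤ[X]), Nat.add_sub_cancel]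
    congr 1
    exact sum_congr rfl fun i _ => by ring
  have hB : ∑ i ∈ Icc 1 q, ∑ j ∈ Icc 1 k,
      (-X ^ (i * k * p + 1) + X ^ (i * k * p + 2)
        - X ^ (i * k * p + 2 + i) + X ^ ((i * k + 1) * p)) * X ^ ((j - 1) * p) =
      -∑ m ∈ range (q * k), (X : ℤ[X]) ^ (k * p + 1 + m * p)
        + ∑ m ∈ range (q * k), X ^ (k * p + 2 + m * p)
        - ∑ i ∈ range q, ∑ j ∈ range k, X ^ ((i + 1) * k * p + 3 + i + j * p)
        + ∑ m ∈ range (q * k), X ^ (k * p + p + m * p) := by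
    simp only [sum_Icc_one_eq_sum_range, ← sum_range_sum_range_add_mul, ← sum_neg_distrib,
      ← sum_add_distrib, ← sum_sub_distrib, Nat.add_sub_cancel]
    exact sum_congr rfl fun i _ => sum_congr rfl fun j _ => by ring
  have hC : ∑ i ∈ Icc 1 (k + 1),
      (-X ^ (k * p * (q + 1) + 1) + X ^ (k * p * (q + 1) + 2)) * X ^ ((i - 1) * p) =
      -X ^ (k * p + 1 + q * k * p)
        - ∑ i ∈ range k, (X : ℤ[X]) ^ (k * p * (q + 1) + 1 + p + i * p)
        + ∑ i ∈ range (k + 1), X ^ (k * p * (q + 1) + 2 + i * p) := by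
    have h : ∑ i ∈ range (k + 1), (X : ℤ[X]) ^ (k * p * (q + 1) + 1 + i * p) =
        X ^ (k * p + 1 + q * k * p)
          + ∑ i ∈ range k, X ^ (k * p * (q + 1) + 1 + p + i * p) := by
      rw [sum_range_succ', add_comm]
      congr 1
      · ring
      · exact sum_congr rfl fun i _ => by ring
    rw [← neg_add', ← h, sum_Icc_one_eq_sum_range, ← sum_neg_distrib, ← sum_add_distrib]
    exact sum_congr rfl fun i _ => by rw [Nat.add_sub_cancel]; ring
  have hP' : P = ∑ i ∈ range (k + 1), X ^ (0 + i * p)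
      + ∑ i ∈ range (k + 1), X ^ (k * p * (q + 1) + 2 + i * p)
      - (∑ i ∈ range k, X ^ (1 + i * p)
        + ∑ i ∈ range k, X ^ (k * p * (q + 1) + 1 + p + i * p))
      - ∑ m ∈ range (q * k + 1), X ^ (k * p + 1 + m * p)
      + (∑ m ∈ range (q * k), X ^ (k * p + 2 + m * p)
        + ∑ m ∈ range (q * k), X ^ (k * p + p + m * p))
      - ∑ i ∈ range q, ∑ j ∈ range k, X ^ ((i + 1) * k * p + 3 + i + j * p) := by
    rw [hP, hA, hB, hC, sum_range_succ _ (q * k)]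
    ring
  rw [hP']
  simp only [reflect_add, reflect_sub]
  rw [reflect_sum_range_sum_range_X_pow q k p hq,
    reflect_sum_range_X_pow (a := 0) (b := k * p * (q + 1) + 2) (by ring),
    reflect_sum_range_X_pow (a := k * p * (q + 1) + 2) (b := 0) (by ring),
    reflect_sum_range_X_pow (a := 1) (b := k * p * (q + 1) + 1 + p) (by ring),
    reflect_sum_range_X_pow (a := k * p * (q + 1) + 1 + p) (b := 1) (by ring),
    reflect_sum_range_X_pow (a := k * p + 1) (b := k * p + 1) (by ring),
    reflect_sum_range_X_pow (a := k * p + 2) (b := k * p + p) (by ring),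
    reflect_sum_range_X_pow (a := k * p + p) (b := k * p + 2) (by ring)]
  ring
end

section
/- Let n ≥ 2 and let i(1), …, i(n−1) be a sequence of indices with {i(1), i(2), …, i(n−1)} = {1, 2, …, n−1}. Then for every integer m ≥ 0, the braid σ_{i(1)} σ_{i(2)} ⋯ σ_{i(n−1)} (σ_1 σ_2 ⋯ σ_{n−1})^{nm} is conjugate in the braid group B_n to (σ_1 σ_2 ⋯ σ_{n−1})^{nm+1}. -/
/-- The braid relations on `n − 1` generators `σ_1, …, σ_{n−1}` (indexed here by
`Fin (n − 1)`, with index `i` corresponding to `σ_{i+1}`): commutation relations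
`σ_i σ_j = σ_j σ_i` for `|i − j| ≥ 2` and `σ_i σ_{i+1} σ_i = σ_{i+1} σ_i σ_{i+1}`. -/
def braidRels (n : ℕ) : Set (FreeGroup (Fin (n - 1))) :=
  {r | (∃ i j : Fin (n - 1), (i : ℕ) + 2 ≤ (j : ℕ) ∧
          r = FreeGroup.of i * FreeGroup.of j * (FreeGroup.of i)⁻¹ * (FreeGroup.of j)⁻¹) ∨
       (∃ i j : Fin (n - 1), (i : ℕ) + 1 = (j : ℕ) ∧
          r = FreeGroup.of i * FreeGroup.of j * FreeGroup.of i *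
                (FreeGroup.of j * FreeGroup.of i * FreeGroup.of j)⁻¹)}

/-- The braid group `B_n` as a presented group. -/
abbrev BraidGroup (n : ℕ) := PresentedGroup (braidRels n)

/-- The standard generator `σ_{i+1}` of the braid group. -/
def braidGen {n : ℕ} (i : Fin (n - 1)) : BraidGroup n := PresentedGroup.of i

/-- The braid `δ = σ_1 σ_2 ⋯ σ_{n−1}`, whose `n`-th power is the full twist. -/
def braidDelta (n : ℕ) : BraidGroup n :=
  ((List.finRange (n - 1)).map braidGen).prod

section ArtinSequence

variable {G : Type*} [Group G]

theorem isConj_prod_append_comm (a b : List G) : IsConj (a ++ b).prod (b ++ a).prod := by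
  rw [isConj_iff]
  exact ⟨a.prod⁻¹, by simp⟩

/-- If `s 0, …, s (N - 1)` commute whenever their indices are at distance at least two, then
their products in any two orders are conjugate. -/
theorem isConj_prod_of_perm_range (N : ℕ) : ∀ (s : ℕ → G)
    (_ : ∀ i j, i + 2 ≤ j → j < N → Commute (s i) (s j))
    (l : List ℕ) (_ : l.Perm (List.range N)),
    IsConj (l.map s).prod ((List.range N).map s).prod := by
  induction N with
  | zero =>
    intro s _ l hl
    simp_all
  | succ N ih =>
    intro s hs l hl
    rcases N with _ | k
    · have : l = [0] := by simpa using hl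
      rw [this, List.range_one]
    have hk : k ∈ l := hl.mem_iff.2 (by simp)
    obtain ⟨p, q, rfl⟩ := List.append_of_mem hk
    have hrot : (k :: (q ++ p)).Perm (List.range (k + 1 + 1)) :=
      (List.perm_append_comm (l₁ := k :: q) (l₂ := p)).trans hl
    have hmem : k + 1 ∈ q ++ p := by
      have : k + 1 ∈ k :: (q ++ p) := hrot.mem_iff.2 (by simp)
      simpa using this
    obtain ⟨a, b, hab⟩ := List.append_of_mem hmem
    rw [hab] at hrot
    have hperm : (k :: (a ++ b)).Perm (List.range (k + 1)) := by
      refine List.Perm.cons_inv (a := k + 1) ?_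
      refine List.Perm.trans ?_ (hrot.trans ?_)
      · exact (List.perm_middle (l₁ := k :: a) (l₂ := b)).symm
      · rw [List.range_succ]
        exact List.perm_append_comm
    have hlt : ∀ x ∈ a ++ b, x < k := by
      intro x hx
      have h1 : x < k + 1 := List.mem_range.1 (hperm.mem_iff.1 (List.mem_cons_of_mem _ hx))
      have h2 : x ≠ k := by
        rintro rfl
        exact (List.nodup_cons.1 (hperm.nodup_iff.2 List.nodup_range)).1 hx
      omega
    let t : ℕ → G := Function.update s k (s k * s (k + 1))
    have ht : ∀ x < k, t x = s x := fun x hx => Function.update_of_ne hx.ne _ _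
    have htk : t k = s k * s (k + 1) := Function.update_self _ _ _
    have hcomm : ∀ i j, i + 2 ≤ j → j < k + 1 → Commute (t i) (t j) := by
      intro i j hij hj
      rw [ht i (by omega)]
      rcases Nat.lt_succ_iff_lt_or_eq.1 hj with h | rfl
      · rw [ht j h]
        exact hs i j hij (by omega)
      · rw [htk]
        exact (hs i j hij (by omega)).mul_right (hs i (j + 1) (by omega) (by omega))
    have hmerge : ((k :: (a ++ (k + 1) :: b)).map s).prod = ((k :: (a ++ b)).map t).prod := by
      have hmap : (a ++ b).map t = (a ++ b).map s :=
        List.map_congr_left fun x hx => ht x (hlt x hx)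
      have hc : Commute (a.map s).prod (s (k + 1)) := by
        refine Commute.list_prod_left _ _ fun y hy => ?_
        obtain ⟨x, hx, rfl⟩ := List.mem_map.1 hy
        have := hlt x (List.mem_append_left _ hx)
        exact hs x (k + 1) (by omega) (by omega)
      rw [List.map_cons, List.map_cons, hmap, htk]
      simp only [List.map_append, List.map_cons, List.prod_cons, List.prod_append]
      rw [← mul_assoc (a.map s).prod, hc.eq]
      simp only [mul_assoc]
    have hstd : ((List.range (k + 1)).map t).prod = ((List.range (k + 1 + 1)).map s).prod := by
      rw [List.prod_range_succ, List.prod_range_succ, List.prod_range_succ, htk, mul_assoc]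
      congr 2
      exact List.map_congr_left fun x hx => ht x (List.mem_range.1 hx)
    have hconj : IsConj ((p ++ k :: q).map s).prod ((k :: (a ++ (k + 1) :: b)).map s).prod := by
      rw [← hab, List.map_append, ← List.cons_append, List.map_append]
      exact isConj_prod_append_comm _ _
    rw [← hstd]
    rw [hmerge] at hconj
    exact hconj.trans (ih t hcomm _ hperm)

theorem prod_range_mul_eq (N : ℕ) (s : ℕ → G)
    (hs : ∀ i j, i + 2 ≤ j → j < N → Commute (s i) (s j))
    (hb : ∀ i, i + 1 < N → s i * s (i + 1) * s i = s (i + 1) * s i * s (i + 1))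
    (i : ℕ) (hi : i + 1 < N) :
    ((List.range N).map s).prod * s i = s (i + 1) * ((List.range N).map s).prod := by
  induction N with
  | zero => omega
  | succ N ih =>
    rw [List.prod_range_succ]
    rcases Nat.lt_succ_iff_lt_or_eq.1 hi with h | rfl
    · rw [mul_assoc, ← (hs i N (by omega) (by omega)).eq, ← mul_assoc,
        ih (fun i j hij hj => hs i j hij (by omega)) (fun i hi => hb i (by omega)) h, mul_assoc]
    · have hc : Commute ((List.range i).map s).prod (s (i + 1)) := by
        refine Commute.list_prod_left _ _ fun y hy => ?_
        obtain ⟨x, hx, rfl⟩ := List.mem_map.1 hy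
        have := List.mem_range.1 hx
        exact hs x (i + 1) (by omega) (by omega)
      rw [List.prod_range_succ, mul_assoc, mul_assoc, ← mul_assoc (s i), hb i (by omega),
        mul_assoc, ← mul_assoc, hc.eq]
      simp only [mul_assoc]

/-- In a sequence satisfying the braid relations, the full twist commutes with the generators. -/
theorem commute_prod_range_pow (k : ℕ) (s : ℕ → G)
    (hs : ∀ i j, i + 2 ≤ j → j < k + 1 → Commute (s i) (s j))
    (hb : ∀ i, i + 1 < k + 1 → s i * s (i + 1) * s i = s (i + 1) * s i * s (i + 1))
    (i : ℕ) (hi : i < k + 1) :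
    Commute (((List.range (k + 1)).map s).prod ^ (k + 2)) (s i) := by
  have hshift := prod_range_mul_eq (k + 1) s hs hb
  have hleft : ((List.range (k + 1)).map s).prod =
      s 0 * ((List.range k).map fun x => s (x + 1)).prod := List.prod_range_succ' s k
  have hright := List.prod_range_succ s k
  set d := ((List.range (k + 1)).map s).prod
  have hpow : ∀ j < k + 1, d ^ j * s 0 = s j * d ^ j := by
    intro j hj
    induction j with
    | zero => simp
    | succ j ih =>
      rw [pow_succ', mul_assoc, ih (by omega), ← mul_assoc, hshift j hj, mul_assoc]
  have hprod : ∀ j < k + 1, d * ((List.range j).map s).prod =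
      ((List.range j).map fun x => s (x + 1)).prod * d := by
    intro j hj
    induction j with
    | zero => simp
    | succ j ih =>
      rw [List.prod_range_succ, List.prod_range_succ, ← mul_assoc, ih (by omega), mul_assoc,
        hshift j hj, mul_assoc]
  have hsq : d * d * s k = s 0 * (d * d) := by
    have hd : d * d = ((List.range k).map fun x => s (x + 1)).prod * d * s k := by
      rw [← hprod k (by omega), mul_assoc, ← hright]
    conv_rhs => rw [hd, ← mul_assoc, ← mul_assoc, ← hleft]
  have hzero : Commute (d ^ (k + 2)) (s 0) := by
    rw [Commute, SemiconjBy, add_comm, pow_add, mul_assoc, hpow k (by omega), pow_two,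
      ← mul_assoc, hsq, mul_assoc]
  have hconj : s i = d ^ i * s 0 * (d ^ i)⁻¹ := by
    rw [hpow i hi, mul_inv_cancel_right]
  have hd : Commute (d ^ (k + 2)) (d ^ i) := (Commute.refl d).pow_pow _ _
  rw [hconj]
  exact (hd.mul_right hzero).mul_right hd.inv_right

end ArtinSequence

theorem braidGen_commute {n : ℕ} (i j : Fin (n - 1)) (h : (i : ℕ) + 2 ≤ j) :
    Commute (braidGen i : BraidGroup n) (braidGen j) := by
  have : PresentedGroup.mk (braidRels n) _ = 1 :=
    PresentedGroup.one_of_mem (rels := braidRels n) (Or.inl ⟨i, j, h, rfl⟩)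
  simp only [map_mul, map_inv] at this
  exact mul_inv_eq_iff_eq_mul.1 (mul_inv_eq_one.1 this)

theorem braidGen_braid {n : ℕ} (i j : Fin (n - 1)) (h : (i : ℕ) + 1 = j) :
    (braidGen i * braidGen j * braidGen i : BraidGroup n) =
      braidGen j * braidGen i * braidGen j := by
  have : PresentedGroup.mk (braidRels n) _ = 1 :=
    PresentedGroup.one_of_mem (rels := braidRels n) (Or.inr ⟨i, j, h, rfl⟩)
  simp only [map_mul, map_inv] at this
  exact mul_inv_eq_one.1 this

/-- The standard generators, extended by `1` to all natural numbers. -/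
def braidGenNat (n i : ℕ) : BraidGroup n := if h : i < n - 1 then braidGen ⟨i, h⟩ else 1

theorem braidGenNat_val {n : ℕ} (i : Fin (n - 1)) : braidGenNat n i = braidGen i :=
  dif_pos i.isLt

theorem braidGenNat_commute (n i j : ℕ) (h : i + 2 ≤ j) (hj : j < n - 1) :
    Commute (braidGenNat n i) (braidGenNat n j) := by
  simpa only [← braidGenNat_val] using braidGen_commute ⟨i, by omega⟩ ⟨j, hj⟩ h

theorem braidGenNat_braid (n i : ℕ) (h : i + 1 < n - 1) :
    braidGenNat n i * braidGenNat n (i + 1) * braidGenNat n i =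
      braidGenNat n (i + 1) * braidGenNat n i * braidGenNat n (i + 1) := by
  simpa only [← braidGenNat_val] using braidGen_braid ⟨i, by omega⟩ ⟨i + 1, h⟩ rfl

theorem braidDelta_eq_prod_range (n : ℕ) :
    braidDelta n = ((List.range (n - 1)).map (braidGenNat n)).prod := by
  rw [braidDelta, ← List.map_coe_finRange_eq_range, List.map_map]
  congr 1
  exact List.map_congr_left fun i _ => (braidGenNat_val i).symm

theorem commute_braidDelta_pow (n : ℕ) (hn : 2 ≤ n) (x : BraidGroup n) :
    Commute (braidDelta n ^ n) x := by
  suffices h : (⊤ : Subgroup (BraidGroup n)) ≤ Subgroup.centralizer {braidDelta n ^ n} from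
    Subgroup.mem_centralizer_singleton_iff.1 (h (Subgroup.mem_top x)) |>.symm
  rw [← PresentedGroup.closure_range_of, Subgroup.closure_le]
  rintro _ ⟨i, rfl⟩
  refine Subgroup.mem_centralizer_singleton_iff.2 (Eq.symm ?_)
  obtain ⟨k, rfl⟩ := Nat.exists_eq_add_of_le' hn
  have := commute_prod_range_pow k (braidGenNat (k + 2)) (braidGenNat_commute (k + 2))
    (braidGenNat_braid (k + 2)) i i.isLt
  rw [braidGenNat_val] at this
  rw [braidDelta_eq_prod_range]
  exact this

theorem isConj_prod_braidGen (n : ℕ) (f : Fin (n - 1) → Fin (n - 1))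
    (hf : Function.Surjective f) :
    IsConj ((List.finRange (n - 1)).map (fun j => (braidGen (f j) : BraidGroup n))).prod
      (braidDelta n) := by
  have hperm : ((List.finRange (n - 1)).map (fun j => (f j : ℕ))).Perm
      (List.range (n - 1)) := by
    rw [← List.map_coe_finRange_eq_range]
    have := (Equiv.Perm.map_finRange_perm
      (Equiv.ofBijective f (Finite.surjective_iff_bijective.1 hf))).map
      (fun i : Fin (n - 1) => (i : ℕ))
    simpa [List.map_map, Function.comp_def] using this
  have := isConj_prod_of_perm_range (n - 1) (braidGenNat n) (braidGenNat_commute n) _ hperm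
  rw [← braidDelta_eq_prod_range, List.map_map] at this
  simpa only [Function.comp_def, braidGenNat_val] using this

/-- If `i(1), …, i(n−1)` runs over all of `{1, …, n−1}`, then for every `m ≥ 0` the braid
`σ_{i(1)} σ_{i(2)} ⋯ σ_{i(n−1)} (σ_1 σ_2 ⋯ σ_{n−1})^{nm}` is conjugate in `B_n` to
`(σ_1 σ_2 ⋯ σ_{n−1})^{nm+1}`. -/
theorem braid_conj_full_twist (n : ℕ) (hn : 2 ≤ n)
    (f : Fin (n - 1) → Fin (n - 1)) (hf : Function.Surjective f) (m : ℕ) :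
    IsConj
      (((List.finRange (n - 1)).map (fun j => braidGen (f j))).prod *
        (braidDelta n) ^ (n * m))
      ((braidDelta n) ^ (n * m + 1)) := by
  obtain ⟨c, hc⟩ := isConj_iff.1 (isConj_prod_braidGen n f hf)
  have hz : Commute (braidDelta n ^ (n * m)) c⁻¹ := by
    rw [pow_mul]
    exact (commute_braidDelta_pow n hn c⁻¹).pow_left m
  refine isConj_iff.2 ⟨c, ?_⟩
  rw [← mul_assoc, mul_assoc _ _ c⁻¹, hz.eq, ← mul_assoc, hc, pow_succ']
end
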